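/- Let V be a real vector space, M ⊆ V a nonempty convex set whose affine span is all of V, and ≽ a preorder on M satisfying SI, with positive cone C = {λ•(x − y) : λ > 0, x, y ∈ M, x ≽ y}. Then ≽ satisfies SD (singleton domination) if and only if C has nonempty relative algebraic interior, i.e., there exists v ∈ C such that for every w in the linear span of C there is ε > 0 with v + ε•w ∈ C. -/

import Mathlib

open Cardinal

variable {V : Type*} [AddCommGroup V] [Module ℝ V]

/-- `u : V → ℝ` is mixture preserving on the convex set `M`. -/
def MixPres (M : Set V) (u : V → ℝ) : Prop :=
  ∀ x ∈ M, ∀ y ∈ M, ∀ α : ℝ, 0 ≤ α → α ≤ 1 →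
    u (α • x + (1 - α) • y) = α * u x + (1 - α) * u y

/-- Axiom MR: existence of a mixture-preserving multi-representation of `r` on `M`. -/
def AxMR (M : Set V) (r : V → V → Prop) : Prop :=
  ∃ U : Set (V → ℝ), U.Nonempty ∧ (∀ u ∈ U, MixPres M u) ∧
    ∀ x ∈ M, ∀ y ∈ M, (r x y ↔ ∀ u ∈ U, u x ≥ u y)

/-- Axiom MC (mixture continuity). -/
def AxMC (M : Set V) (r : V → V → Prop) : Prop :=
  ∀ x ∈ M, ∀ y ∈ M, ∀ z ∈ M,
    (∀ α : ℝ, 0 < α → α ≤ 1 →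
      r (α • x + (1 - α) • y) z ∧ ¬ r z (α • x + (1 - α) • y)) →
    r y z

/-- Axiom SI (strong independence). -/
def AxSI (M : Set V) (r : V → V → Prop) : Prop :=
  ∀ x ∈ M, ∀ y ∈ M, ∀ z ∈ M, ∀ α : ℝ, 0 < α → α < 1 →
    (r x y ↔ r (α • x + (1 - α) • z) (α • y + (1 - α) • z))

/-- Axiom CD (countable domination). -/
def AxCD (M : Set V) (r : V → V → Prop) : Prop :=
  ∃ D : Set (V × V), D.Countable ∧
    (∀ p ∈ D, p.1 ∈ M ∧ p.2 ∈ M ∧ r p.1 p.2) ∧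
    ∀ s ∈ M, ∀ t ∈ M, r s t →
      ∃ p ∈ D, ∃ α : ℝ, 0 < α ∧ α < 1 ∧
        r (α • p.1 + (1 - α) • t) (α • p.2 + (1 - α) • s)

/-- Axiom SD (singleton domination). -/
def AxSD (M : Set V) (r : V → V → Prop) : Prop :=
  ∃ x ∈ M, ∃ y ∈ M, r x y ∧
    ∀ s ∈ M, ∀ t ∈ M, r s t →
      ∃ α : ℝ, 0 < α ∧ α < 1 ∧
        r (α • x + (1 - α) • t) (α • y + (1 - α) • s)

/-- The positive cone of the preorder `r` on `M`. -/
def posCone (M : Set V) (r : V → V → Prop) : Set V :=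
  {v | ∃ l : ℝ, 0 < l ∧ ∃ x ∈ M, ∃ y ∈ M, r x y ∧ v = l • (x - y)}

/-- A set is algebraically closed. -/
def AlgClosed (S : Set V) : Prop :=
  ∀ v w : V, (∀ α : ℝ, 0 < α → α ≤ 1 → (1 - α) • v + α • w ∈ S) → v ∈ S

/-- The weak topology on a real vector space: the coarsest topology making all
linear functionals continuous. -/
def weakTop (W : Type*) [AddCommGroup W] [Module ℝ W] : TopologicalSpace W :=
  ⨅ f : W →ₗ[ℝ] ℝ, TopologicalSpace.induced (⇑f) inferInstance

/-- The linear span of the set of differences of elements of `M`. -/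
def diffSpan (M : Set V) : Submodule ℝ V :=
  Submodule.span ℝ {v | ∃ x ∈ M, ∃ y ∈ M, v = x - y}

/-- `u` is strictly increasing for `r` on `M`. -/
def StrIncr (M : Set V) (r : V → V → Prop) (u : V → ℝ) : Prop :=
  (∀ x ∈ M, ∀ y ∈ M, r x y → u x ≥ u y) ∧
  (∀ x ∈ M, ∀ y ∈ M, r x y → ¬ r y x → u x > u y)

theorem smul_mem_posCone {M : Set V} {r : V → V → Prop} {v : V} {c : ℝ} (hc : 0 < c)
    (hv : v ∈ posCone M r) : c • v ∈ posCone M r := by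
  obtain ⟨l, hl, x, hx, y, hy, hxy, rfl⟩ := hv
  exact ⟨c * l, mul_pos hc hl, x, hx, y, hy, hxy, by rw [mul_smul]⟩

theorem sub_mem_posCone {M : Set V} {r : V → V → Prop} {x y : V} (hx : x ∈ M) (hy : y ∈ M)
    (h : r x y) : x - y ∈ posCone M r :=
  ⟨1, one_pos, x, hx, y, hy, h, by rw [one_smul]⟩

theorem zero_mem_posCone {M : Set V} {r : V → V → Prop} (hM : M.Nonempty)
    (hrefl : ∀ x ∈ M, r x x) : (0 : V) ∈ posCone M r := by
  obtain ⟨x, hx⟩ := hM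
  simpa using sub_mem_posCone hx hx (hrefl x hx)

/-- Under strong independence the relation is recovered from its positive cone. -/
theorem rel_of_sub_mem_posCone {M : Set V} {r : V → V → Prop} (hSI : AxSI M r) {x y : V}
    (hx : x ∈ M) (hy : y ∈ M) (h : x - y ∈ posCone M r) : r x y := by
  obtain ⟨l, hl, a, ha, b, hb, hab, hxy⟩ := h
  have hl' : (1 + l) ≠ 0 := by positivity
  have h0 : 0 < 1 / (1 + l) := by positivity
  have h1 : 1 / (1 + l) < 1 := by rw [div_lt_one (by positivity)]; linarith
  rw [hSI x hx y hy b hb (1 / (1 + l)) h0 h1]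
  have key := (hSI a ha b hb y hy (1 - 1 / (1 + l)) (by linarith) (by linarith)).1 hab
  have hx' : x = y + l • (a - b) := by rw [← hxy]; abel
  convert key using 1
  · rw [hx']
    match_scalars <;> field_simp <;> ring
  · match_scalars <;> ring

theorem add_mem_posCone {M : Set V} {r : V → V → Prop} (hconv : Convex ℝ M)
    (htrans : ∀ x ∈ M, ∀ y ∈ M, ∀ z ∈ M, r x y → r y z → r x z)
    (hSI : AxSI M r) {v w : V} (hv : v ∈ posCone M r) (hw : w ∈ posCone M r) :
    v + w ∈ posCone M r := by
  obtain ⟨l, hl, x, hx, y, hy, hxy, rfl⟩ := hv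
  obtain ⟨m, hm, s, hs, t, ht, hst, rfl⟩ := hw
  obtain ⟨α, hα⟩ : ∃ α, α = l / (l + m) := ⟨_, rfl⟩
  have h0 : 0 < α := by rw [hα]; positivity
  have h1 : α < 1 := by rw [hα, div_lt_one (by positivity)]; linarith
  have mix : ∀ a ∈ M, ∀ b ∈ M, α • a + (1 - α) • b ∈ M := fun a ha b hb =>
    hconv ha hb h0.le (by linarith) (by ring)
  refine ⟨l + m, by positivity, α • x + (1 - α) • s, mix x hx s hs, α • y + (1 - α) • t,
    mix y hy t ht, ?_, ?_⟩
  · refine htrans _ (mix x hx s hs) _ (mix y hy s hs) _ (mix y hy t ht)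
      ((hSI x hx y hy s hs α h0 h1).1 hxy) ?_
    have := (hSI s hs t ht y hy (1 - α) (by linarith) (by linarith)).1 hst
    rwa [sub_sub_cancel, add_comm, add_comm _ (α • y)] at this
  · have e : l + m ≠ 0 := by positivity
    rw [hα]
    match_scalars <;> field_simp <;> ring

/-- Every vector of the span of the positive cone is a difference of two cone elements. -/
theorem exists_sub_of_mem_span_posCone {M : Set V} {r : V → V → Prop} (hM : M.Nonempty)
    (hconv : Convex ℝ M) (hrefl : ∀ x ∈ M, r x x)
    (htrans : ∀ x ∈ M, ∀ y ∈ M, ∀ z ∈ M, r x y → r y z → r x z)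
    (hSI : AxSI M r) {w : V} (hw : w ∈ Submodule.span ℝ (posCone M r)) :
    ∃ a ∈ posCone M r, ∃ b ∈ posCone M r, w = a - b := by
  have h0 : (0 : V) ∈ posCone M r := zero_mem_posCone hM hrefl
  induction hw using Submodule.span_induction with
  | mem x hx => exact ⟨x, hx, 0, h0, by simp⟩
  | zero => exact ⟨0, h0, 0, h0, by simp⟩
  | add x y _ _ hx hy =>
    obtain ⟨a, ha, b, hb, rfl⟩ := hx
    obtain ⟨c, hc, d, hd, rfl⟩ := hy
    exact ⟨a + c, add_mem_posCone hconv htrans hSI ha hc, b + d,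
      add_mem_posCone hconv htrans hSI hb hd, by abel⟩
  | smul c x _ hx =>
    obtain ⟨a, ha, b, hb, rfl⟩ := hx
    rcases lt_trichotomy c 0 with hc | rfl | hc
    · have hc' : 0 < -c := by linarith
      exact ⟨(-c) • b, smul_mem_posCone hc' hb, (-c) • a, smul_mem_posCone hc' ha, by module⟩
    · exact ⟨0, h0, 0, h0, by simp⟩
    · exact ⟨c • a, smul_mem_posCone hc ha, c • b, smul_mem_posCone hc hb, by module⟩


theorem stmt_9 (M : Set V) (hM : M.Nonempty) (hconv : Convex ℝ M)
    (haff : affineSpan ℝ M = ⊤)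
    (r : V → V → Prop) (hrefl : ∀ x ∈ M, r x x)
    (htrans : ∀ x ∈ M, ∀ y ∈ M, ∀ z ∈ M, r x y → r y z → r x z)
    (hSI : AxSI M r) :
    AxSD M r ↔
      ∃ v ∈ posCone M r, ∀ w ∈ Submodule.span ℝ (posCone M r),
        ∃ ε : ℝ, 0 < ε ∧ v + ε • w ∈ posCone M r := by
  constructor
  · rintro ⟨x, hx, y, hy, hxy, hdom⟩
    refine ⟨x - y, sub_mem_posCone hx hy hxy, fun w hw => ?_⟩
    obtain ⟨a, ha, b, ⟨l, hl, s, hs, t, ht, hst, rfl⟩, rfl⟩ :=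
      exists_sub_of_mem_span_posCone hM hconv hrefl htrans hSI hw
    obtain ⟨α, h0, h1, h⟩ := hdom s hs t ht hst
    have h1' : 0 < 1 - α := by linarith
    have hε : 0 < (1 - α) / (α * l) := by positivity
    refine ⟨(1 - α) / (α * l), hε, ?_⟩
    have hmem := sub_mem_posCone (hconv hx ht h0.le h1'.le (by ring))
      (hconv hy hs h0.le h1'.le (by ring)) h
    convert add_mem_posCone hconv htrans hSI (smul_mem_posCone (inv_pos.2 h0) hmem)
      (smul_mem_posCone hε ha) using 1
    match_scalars <;> field_simp
  · rintro ⟨_, ⟨l, hl, x, hx, y, hy, hxy, rfl⟩, hv⟩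
    refine ⟨x, hx, y, hy, hxy, fun s hs t ht hst => ?_⟩
    obtain ⟨ε, hε, h⟩ := hv (-(s - t))
      (neg_mem (Submodule.subset_span (sub_mem_posCone hs ht hst)))
    have h0 : 0 < l / (l + ε) := by positivity
    have h1 : l / (l + ε) < 1 := by rw [div_lt_one (by positivity)]; linarith
    refine ⟨l / (l + ε), h0, h1, rel_of_sub_mem_posCone hSI
      (hconv hx ht h0.le (by linarith) (by ring))
      (hconv hy hs h0.le (by linarith) (by ring)) ?_⟩
    have hsum : 0 < l + ε := by positivity
    convert smul_mem_posCone (inv_pos.2 hsum) h using 1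
    match_scalars <;> field_simp <;> ring
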